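/- arXiv:2512.03916 — 3 statements merged into one kernel-verified Lean document; each statement's English description precedes it below -/
import Mathlib

section
/- Let D1 and D2 be totally ordered idempotent commutative dioids and form D1 Δ D2, taking D2 in the role of the commutative semiring A (so D1 Δ D2 = {(d1,d2) ∈ D1 × D2 : d1 ∈ reg(D1) or d2 = ∞_2}, the operation ⊕ combines second coordinates with min_2, and (d1,d2) ⊗ (d1',d2') = (d1 +_1 d1', d2 +_2 d2')). Then: (a) ⊕ is idempotent, i.e., p ⊕ p = p for every p ∈ D1 × D2; (b) for all p, q ∈ D1 Δ D2, there exists r ∈ D1 Δ D2 with q ⊕ r = p if and only if p is below q in the lexicographic order, i.e., p.1 <_1 q.1, or (p.1 ≤_1 q.1 and p.2 ≤_2 q.2). Consequently D1 Δ D2 is again a totally ordered idempotent commutative dioid whose canonical order is the lexicographic order built from ≤_1 and ≤_2. -/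
open scoped Classical

/-- The canonical order of a dioid whose addition (written `min` in the paper) is `+`:
`d1 ≤_D d2` iff there exists `c` with `min(d2, c) = d1`. -/
def dioidLe {D : Type*} [CommSemiring D] (d1 d2 : D) : Prop := ∃ c, d2 + c = d1

/-- `d1 <_D d2` means `d1 ≤_D d2` and `d1 ≠ d2`. -/
def dioidLt {D : Type*} [CommSemiring D] (d1 d2 : D) : Prop := dioidLe d1 d2 ∧ d1 ≠ d2

/-- A multiplicatively regular element of a commutative semiring; in a dioid this is taken with
respect to the multiplication `+_D` (which is `*`) and the zero `∞_D` (which is `0`). -/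
def IsMultReg {A : Type*} [CommSemiring A] (a : A) : Prop :=
  a ≠ 0 ∧ ∀ b c : A, a * b = a * c → b = c

/-- The underlying set of the Δ-product `D1 Δ D2`, the second dioid `D2` playing the role of the
commutative semiring (so `0_A` is `∞_2`, i.e. `(0 : D2)`). -/
def deltaSet (D A : Type*) [CommSemiring D] [CommSemiring A] : Set (D × A) :=
  {p | IsMultReg p.1 ∨ p.2 = 0}

/-- The addition `⊕` of the Δ-product: second coordinates are combined using the addition of the
second factor, which for `D1 Δ D2` is `min_2`. -/
noncomputable def deltaAdd {D A : Type*} [CommSemiring D] [CommSemiring A]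
    (p q : D × A) : D × A :=
  (p.1 + q.1, if p.1 = q.1 then p.2 + q.2 else if dioidLe p.1 q.1 then p.2 else q.2)

/-- The multiplication `⊗` of the Δ-product: for `D1 Δ D2` it is
`(d1, d2) ⊗ (d1', d2') = (d1 +_1 d1', d2 +_2 d2')`. -/
def deltaMul {D A : Type*} [CommSemiring D] [CommSemiring A] (p q : D × A) : D × A :=
  (p.1 * q.1, p.2 * q.2)

theorem dioidLe_iff_add_eq {D : Type*} [CommSemiring D] (hidem : ∀ d : D, d + d = d) {a b : D} :
    dioidLe a b ↔ b + a = a := by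
  refine ⟨?_, fun h => ⟨a, h⟩⟩
  rintro ⟨c, rfl⟩
  rw [← add_assoc, hidem]

theorem dioidLe_refl {D : Type*} [CommSemiring D] (a : D) : dioidLe a a :=
  ⟨0, add_zero a⟩

theorem dioidLe_antisymm {D : Type*} [CommSemiring D] (hidem : ∀ d : D, d + d = d) {a b : D}
    (hab : dioidLe a b) (hba : dioidLe b a) : a = b := by
  rw [dioidLe_iff_add_eq hidem] at hab hba
  rw [← hab, add_comm, hba]

theorem dioidLt_or_dioidLt_of_ne {D : Type*} [CommSemiring D]
    (htot : ∀ a b : D, dioidLe a b ∨ dioidLe b a) {a b : D} (h : a ≠ b) :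
    dioidLt a b ∨ dioidLt b a :=
  (htot a b).imp (fun hab => ⟨hab, h⟩) (fun hba => ⟨hba, h.symm⟩)

section DeltaAdd

variable {D A : Type*} [CommSemiring D] [CommSemiring A]

theorem deltaAdd_of_fst_eq (hidem : ∀ d : D, d + d = d) {p q : D × A} (h : p.1 = q.1) :
    deltaAdd p q = (q.1, p.2 + q.2) := by
  simp [deltaAdd, h, hidem]

theorem deltaAdd_of_fst_lt (hidem : ∀ d : D, d + d = d) {p q : D × A} (h : dioidLt p.1 q.1) :
    deltaAdd p q = p := by
  have hadd := (dioidLe_iff_add_eq hidem).1 h.1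
  simp [deltaAdd, h.1, h.2, add_comm p.1, hadd]

theorem deltaAdd_of_fst_gt (hidem : ∀ d : D, d + d = d) {p q : D × A} (h : dioidLt q.1 p.1) :
    deltaAdd p q = q := by
  have hadd := (dioidLe_iff_add_eq hidem).1 h.1
  have hle : ¬ dioidLe p.1 q.1 := fun h' => h.2 (dioidLe_antisymm hidem h.1 h')
  simp [deltaAdd, hle, h.2.symm, hadd]

end DeltaAdd

/-- For totally ordered idempotent commutative dioids `D1` and `D2`, the
Δ-product `D1 Δ D2` is again a totally ordered idempotent commutative dioid whose canonical
order is the lexicographic order: (a) `⊕` is idempotent on `D1 × D2`; (b) for `p, q ∈ D1 Δ D2`,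
`p` is obtained as `q ⊕ r` for some `r ∈ D1 Δ D2` iff `p` is lexicographically below `q`; and
the lexicographic order is total on `D1 Δ D2`. -/
theorem deltaProduct_dioid_lex_order
    {D1 D2 : Type*} [CommSemiring D1] [CommSemiring D2]
    (hidem1 : ∀ d : D1, d + d = d)
    (htot1 : ∀ a b : D1, dioidLe a b ∨ dioidLe b a)
    (hidem2 : ∀ d : D2, d + d = d)
    (htot2 : ∀ a b : D2, dioidLe a b ∨ dioidLe b a) :
    -- (a) idempotence of ⊕
    (∀ p : D1 × D2, deltaAdd p p = p) ∧
    -- (b) the canonical order of D1 Δ D2 is the lexicographic order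
    (∀ p ∈ deltaSet D1 D2, ∀ q ∈ deltaSet D1 D2,
      ((∃ r ∈ deltaSet D1 D2, deltaAdd q r = p) ↔
        (dioidLt p.1 q.1 ∨ (dioidLe p.1 q.1 ∧ dioidLe p.2 q.2)))) ∧
    -- consequently the (lexicographic) order of D1 Δ D2 is total
    (∀ p ∈ deltaSet D1 D2, ∀ q ∈ deltaSet D1 D2,
      (dioidLt p.1 q.1 ∨ (dioidLe p.1 q.1 ∧ dioidLe p.2 q.2)) ∨
      (dioidLt q.1 p.1 ∨ (dioidLe q.1 p.1 ∧ dioidLe q.2 p.2))) := by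
  refine ⟨fun p => ?_, fun p hp q _ => ⟨?_, fun h => ⟨p, hp, ?_⟩⟩, fun p _ q _ => ?_⟩
  · rw [deltaAdd_of_fst_eq hidem1 rfl, hidem2]
  · rintro ⟨r, _, rfl⟩
    by_cases heq : q.1 = r.1
    · rw [deltaAdd_of_fst_eq hidem1 heq]
      exact .inr ⟨heq ▸ dioidLe_refl _, r.2, rfl⟩
    · rcases dioidLt_or_dioidLt_of_ne htot1 heq with hlt | hgt
      · rw [deltaAdd_of_fst_lt hidem1 hlt]
        exact .inr ⟨dioidLe_refl _, dioidLe_refl _⟩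
      · rw [deltaAdd_of_fst_gt hidem1 hgt]
        exact .inl hgt
  · by_cases heq : p.1 = q.1
    · have hle : dioidLe p.2 q.2 := h.elim (fun hlt => absurd heq hlt.2) And.right
      rw [deltaAdd_of_fst_eq hidem1 heq.symm, (dioidLe_iff_add_eq hidem2).1 hle]
    · exact deltaAdd_of_fst_gt hidem1 ⟨h.elim And.left And.left, heq⟩
  · by_cases heq : p.1 = q.1
    · rw [heq]
      exact (htot2 p.2 q.2).imp (fun h => .inr ⟨dioidLe_refl _, h⟩)
        (fun h => .inr ⟨dioidLe_refl _, h⟩)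
    · exact (dioidLt_or_dioidLt_of_ne htot1 heq).imp .inl .inl
end

section
/- Let D be a totally ordered idempotent commutative dioid and A a commutative semiring. Then the set D Δ A is closed under the operations ⊕ and ⊗: if (d1,a1) ∈ D Δ A and (d2,a2) ∈ D Δ A, then (d1,a1) ⊕ (d2,a2) ∈ D Δ A and (d1,a1) ⊗ (d2,a2) ∈ D Δ A. -/
open scoped Classical

theorem IsMultReg.mul {A : Type*} [CommSemiring A] {a b : A}
    (ha : IsMultReg a) (hb : IsMultReg b) : IsMultReg (a * b) := by
  refine ⟨fun h => hb.1 (ha.2 b 0 (by rw [h, mul_zero])), fun c d h => ?_⟩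
  exact hb.2 c d (ha.2 _ _ (by rwa [← mul_assoc, ← mul_assoc]))

theorem dioidLe.add_eq_left {D : Type*} [CommSemiring D] (hidem : ∀ d : D, d + d = d)
    {d1 d2 : D} (h : dioidLe d1 d2) : d1 + d2 = d1 := by
  obtain ⟨c, rfl⟩ := h
  rw [add_right_comm, hidem]

/-- The set `D Δ A` is closed under `⊕` and `⊗`. -/
theorem deltaSet_closed
    {D A : Type*} [CommSemiring D] [CommSemiring A]
    (hidem : ∀ d : D, d + d = d)
    (htot : ∀ d1 d2 : D, dioidLe d1 d2 ∨ dioidLe d2 d1) :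
    ∀ p ∈ deltaSet D A, ∀ q ∈ deltaSet D A,
      deltaAdd p q ∈ deltaSet D A ∧ deltaMul p q ∈ deltaSet D A := by
  rintro ⟨d1, a1⟩ hp ⟨d2, a2⟩ hq
  simp only [deltaSet, Set.mem_ofPred_eq] at hp hq
  constructor
  · simp only [deltaSet, deltaAdd, Set.mem_ofPred_eq]
    split_ifs with heq hle
    · subst heq
      rw [hidem]
      rcases hp with hp | rfl
      · exact Or.inl hp
      · rwa [zero_add]
    · rwa [hle.add_eq_left hidem]
    · rwa [add_comm, ((htot d1 d2).resolve_left hle).add_eq_left hidem]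
  · simp only [deltaSet, deltaMul, Set.mem_ofPred_eq]
    rcases hp with hp | rfl
    · rcases hq with hq | rfl
      · exact Or.inl (hp.mul hq)
      · exact Or.inr (mul_zero _)
    · exact Or.inr (zero_mul _)
end

section
/- Let D be a totally ordered idempotent commutative dioid and A a commutative semiring. Then for all d1, d2 ∈ D and a1, a2 ∈ A, (d1 +_D d2) Δ (a1 ·_A a2) = (d1 Δ a1) ⊗ (d2 Δ a2). -/
open scoped Classical

/-- `d Δ a` is `(d, a)` if `d` is multiplicatively regular and `(d, 0_A)` otherwise. -/
noncomputable def deltaPair {D A : Type*} [CommSemiring D] [CommSemiring A]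
    (d : D) (a : A) : D × A :=
  if IsMultReg d then (d, a) else (d, 0)

theorem isMultReg_mul_iff {D : Type*} [CommSemiring D] (d1 d2 : D) :
    IsMultReg (d1 * d2) ↔ IsMultReg d1 ∧ IsMultReg d2 := by
  constructor
  · rintro ⟨h0, h⟩
    refine ⟨⟨left_ne_zero_of_mul h0, fun b c hbc => h b c ?_⟩,
      ⟨right_ne_zero_of_mul h0, fun b c hbc => h b c ?_⟩⟩
    · rw [mul_right_comm, hbc, mul_right_comm]
    · rw [mul_assoc, hbc, mul_assoc]
  · rintro ⟨⟨_, h1⟩, ⟨h20, h2⟩⟩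
    refine ⟨fun h => h20 (h1 _ _ (by rw [h, mul_zero])), fun b c hbc => h2 _ _ (h1 _ _ ?_)⟩
    rw [← mul_assoc, hbc, mul_assoc]

/-- For all `d1, d2 ∈ D` and `a1, a2 ∈ A`,
`(d1 +_D d2) Δ (a1 ·_A a2) = (d1 Δ a1) ⊗ (d2 Δ a2)`. -/
theorem deltaPair_mul
    {D A : Type*} [CommSemiring D] [CommSemiring A]
    (hidem : ∀ d : D, d + d = d)
    (htot : ∀ d1 d2 : D, dioidLe d1 d2 ∨ dioidLe d2 d1)
    (d1 d2 : D) (a1 a2 : A) :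
    deltaPair (d1 * d2) (a1 * a2) = deltaMul (deltaPair d1 a1) (deltaPair d2 a2) := by
  by_cases h1 : IsMultReg d1 <;> by_cases h2 : IsMultReg d2 <;>
    simp [deltaPair, deltaMul, isMultReg_mul_iff, h1, h2]
end
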